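/- Define a 'slide' on a tree T with vertex set V as follows: given two edges e = {u,v} and f = {u,w} of T sharing the vertex u (with v ≠ w), replace f by the edge {v,w}, provided the result is again a tree. Then any two trees on the same finite vertex set V (with |V| = n ≥ 1) can be connected by a finite sequence of slides. In particular, every tree on {1, …, n} can be transformed by slides into a Hamiltonian path. -/

import Mathlib

/-- A *slide*: given edges `e = {u,v}` and `f = {u,w}` of `G` sharing `u` (with `v ≠ w`),
replace `f` by `{v,w}`, provided the result is again a tree. -/
def Slide {V : Type*} (G G' : SimpleGraph V) : Prop :=
  ∃ u v w : V, v ≠ w ∧ s(u, v) ∈ G.edgeSet ∧ s(u, w) ∈ G.edgeSet ∧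
    G'.edgeSet = (G.edgeSet \ {s(u, w)}) ∪ {s(v, w)} ∧ G'.IsTree

namespace SimpleGraph

variable {V : Type*} {T T' : SimpleGraph V}

lemma Connected.isTree_of_ncard_edgeSet_le [Finite V] (h : T.Connected)
    (hcard : T.edgeSet.ncard + 1 ≤ Nat.card V) : T.IsTree :=
  isTree_iff_connected_and_card.2
    ⟨h, le_antisymm hcard h.card_vert_le_card_edgeSet_add_one⟩

lemma isTree_pathGraph (n : ℕ) : (pathGraph (n + 1)).IsTree := by
  refine (pathGraph_connected n).isTree_of_ncard_edgeSet_le ?_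
  have hsub : (pathGraph (n + 1)).edgeSet ⊆
      Set.range fun i : Fin n => s(i.castSucc, i.succ) := by
    intro e
    induction e with
    | _ a b =>
      rw [mem_edgeSet, pathGraph_adj]
      rintro (h | h)
      · exact ⟨⟨a, by omega⟩, congrArg₂ (fun x y => s(x, y)) (Fin.ext rfl) (Fin.ext h)⟩
      · exact ⟨⟨b, by omega⟩, Sym2.eq_swap.trans
          (congrArg₂ (fun x y => s(x, y)) (Fin.ext h) (Fin.ext rfl))⟩
  have hle := Set.ncard_le_ncard hsub (Set.finite_range _)
  have hrange : (Set.range fun i : Fin n => s(i.castSucc, i.succ)).ncard ≤ n := by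
    rw [← Set.image_univ]
    exact (Set.ncard_image_le Set.finite_univ).trans (by simp [Set.ncard_univ])
  simpa using hle.trans hrange

/-- Sliding the edge `{u,w}` along the edge `{u,v}`. -/
def slideEdge (T : SimpleGraph V) (u v w : V) : SimpleGraph V :=
  fromEdgeSet ((T.edgeSet \ {s(u, w)}) ∪ {s(v, w)})

lemma edgeSet_slideEdge {u v w : V} (hvw : v ≠ w) :
    (T.slideEdge u v w).edgeSet = (T.edgeSet \ {s(u, w)}) ∪ {s(v, w)} := by
  rw [slideEdge, edgeSet_fromEdgeSet, sdiff_eq_left, Set.disjoint_left]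
  rintro e (he | rfl)
  · exact T.not_isDiag_of_mem_edgeSet he.1
  · simpa using hvw

lemma slideEdge_adj_of_adj {u v w a b : V} (h : T.Adj a b) (hne : s(a, b) ≠ s(u, w)) :
    (T.slideEdge u v w).Adj a b := by
  rw [slideEdge, fromEdgeSet_adj]
  exact ⟨Or.inl ⟨h, hne⟩, h.ne⟩

lemma IsTree.slideEdge [Finite V] (hT : T.IsTree) {u v w : V} (hvw : v ≠ w)
    (huv : T.Adj u v) (huw : T.Adj u w) (hn : ¬ T.Adj v w) :
    (T.slideEdge u v w).IsTree := by
  have huv' : (T.slideEdge u v w).Adj u v := slideEdge_adj_of_adj huv (by simp [hvw, huw.ne])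
  have hvw' : (T.slideEdge u v w).Adj v w := by
    rw [← mem_edgeSet, edgeSet_slideEdge hvw]
    exact Or.inr rfl
  have hreach : (T.slideEdge u v w).Reachable u w := huv'.reachable.trans hvw'.reachable
  have hadj : ∀ a b, T.Adj a b → (T.slideEdge u v w).Reachable a b := by
    intro a b hab
    by_cases h : s(a, b) = s(u, w)
    · rcases Sym2.eq_iff.1 h with ⟨rfl, rfl⟩ | ⟨rfl, rfl⟩
      exacts [hreach, hreach.symm]
    · exact (slideEdge_adj_of_adj hab h).reachable
  have hconn : (T.slideEdge u v w).Connected := by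
    have := hT.connected.nonempty
    refine ⟨fun a b => ?_⟩
    obtain ⟨p⟩ := hT.connected.preconnected a b
    induction p with
    | nil => rfl
    | cons h _ ih => exact (hadj _ _ h).trans ih
  refine hconn.isTree_of_ncard_edgeSet_le ?_
  rw [edgeSet_slideEdge hvw, Set.union_singleton, Set.ncard_exchange (by exact hn) (by exact huw)]
  exact (isTree_iff_connected_and_card.1 hT).2.le

end SimpleGraph

open SimpleGraph

lemma slide_slideEdge {V : Type*} [Finite V] {T : SimpleGraph V} (hT : T.IsTree) {u v w : V}
    (hvw : v ≠ w) (huv : T.Adj u v) (huw : T.Adj u w) (hn : ¬ T.Adj v w) :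
    Slide T (T.slideEdge u v w) :=
  ⟨u, v, w, hvw, huv, huw, edgeSet_slideEdge hvw, hT.slideEdge hvw huv huw hn⟩

lemma slideEdge_slide {V : Type*} {T : SimpleGraph V} (hT : T.IsTree) {u v w : V}
    (hvw : v ≠ w) (huv : T.Adj u v) (huw : T.Adj u w) (hn : ¬ T.Adj v w) :
    Slide (T.slideEdge u v w) T := by
  refine ⟨v, u, w, huw.ne, (slideEdge_adj_of_adj huv (by simp [hvw, huw.ne])).symm, ?_, ?_, hT⟩
  · rw [edgeSet_slideEdge hvw]
    exact Or.inr rfl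
  · ext e
    have hu : s(u, w) ∈ T.edgeSet := huw
    have hv : s(v, w) ∉ T.edgeSet := hn
    rw [edgeSet_slideEdge hvw]
    grind

/-- A tree is connected by slides to and from the star centred at any given vertex. -/
lemma reflTransGen_slide_starGraph {V : Type*} [Finite V] (r : V) (T : SimpleGraph V)
    (hT : T.IsTree) : Relation.ReflTransGen Slide T (starGraph r) ∧
      Relation.ReflTransGen Slide (starGraph r) T := by
  induction hk : {x | ¬ T.Adj r x}.ncard using Nat.strong_induction_on generalizing T with
  | _ k ih =>
  by_cases hall : ∀ x, x ≠ r → T.Adj r x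
  · have hle : starGraph r ≤ T := by
      intro a b h
      rw [starGraph_adj] at h
      rcases h with ⟨hne, rfl | rfl⟩
      · exact hall _ hne.symm
      · exact (hall _ hne).symm
    have heq : T = starGraph r := le_antisymm
      ((isTree_iff_minimal_connected.1 hT).2 (isTree_starGraph r).connected hle) hle
    exact heq ▸ ⟨.refl, .refl⟩
  · push Not at hall
    obtain ⟨x, hxr, hx⟩ := hall
    obtain ⟨p⟩ := hT.connected.preconnected r x
    obtain ⟨⟨⟨u, w⟩, huw⟩, -, hu, hw⟩ :=
      p.exists_boundary_dart (insert r {y | T.Adj r y}) (by simp) (by simp [hxr, hx])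
    simp only [Set.mem_insert_iff, Set.mem_ofPred_eq, not_or] at hu hw
    have hru : T.Adj r u := hu.resolve_left (by rintro rfl; exact hw.2 huw)
    have hrw : r ≠ w := Ne.symm hw.1
    have hlt : {y | ¬ (T.slideEdge u r w).Adj r y}.ncard < k := by
      rw [← hk]
      refine Set.ncard_lt_ncard ⟨fun y hy hry => hy ?_, fun h => h hw.2 ?_⟩ (Set.toFinite _)
      · exact slideEdge_adj_of_adj hry (by simp [hru.ne, hrw])
      · rw [← mem_edgeSet, edgeSet_slideEdge hrw]
        exact Or.inr rfl
    obtain ⟨h₁, h₂⟩ := ih _ hlt _ (hT.slideEdge hrw hru.symm huw hw.2) rfl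
    exact ⟨.head (slide_slideEdge hT hrw hru.symm huw hw.2) h₁,
      h₂.tail (slideEdge_slide hT hrw hru.symm huw hw.2)⟩

lemma SimpleGraph.IsTree.reflTransGen_slide {V : Type*} [Finite V] {T T' : SimpleGraph V}
    (hT : T.IsTree) (hT' : T'.IsTree) : Relation.ReflTransGen Slide T T' := by
  obtain ⟨r⟩ := hT.connected.nonempty
  exact (reflTransGen_slide_starGraph r T hT).1.trans (reflTransGen_slide_starGraph r T' hT').2

/-- Any two trees on the same finite nonempty vertex set are connected by a finite
sequence of slides; in particular every tree on `{1, …, n}` can be transformed by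
slides into a Hamiltonian path. -/
theorem trees_connected_by_slides :
    (∀ (V : Type) [Fintype V] [Nonempty V] (T T' : SimpleGraph V),
      T.IsTree → T'.IsTree → Relation.ReflTransGen Slide T T') ∧
    (∀ n : ℕ, 1 ≤ n → ∀ T : SimpleGraph (Fin n), T.IsTree →
      ∃ P : SimpleGraph (Fin n), Nonempty (P ≃g SimpleGraph.pathGraph n) ∧
        Relation.ReflTransGen Slide T P) := by
  refine ⟨fun V _ _ T T' hT hT' => hT.reflTransGen_slide hT', fun n hn T hT => ?_⟩
  obtain ⟨m, rfl⟩ := Nat.exists_eq_add_of_le' hn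
  exact ⟨pathGraph (m + 1), ⟨Iso.refl⟩, hT.reflTransGen_slide (isTree_pathGraph m)⟩
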